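/- Let n ≥ 2, let a_0 ≥ 1 and a_1,…,a_n ≥ 2 be integers, and define F̃(z_0,…,z_n) := z_0^{a_0}z_1 − z_1^{a_1}z_2 + z_2^{a_2}z_3 − ⋯ + (−1)^{n−1}z_{n−1}^{a_{n−1}}z_n + (−1)^n z_n^{a_n}. Let V := {(z_0,…,z_n) ∈ ℂ^{n+1} : F̃(z) = 1 and ∂F̃/∂z_k(z) = 0 for k = 2,…,n}. Then there exists a real number c > 0 such that the projection (z_0,…,z_n) ↦ (z_0,z_1) restricts to a bijection from V onto the affine plane curve {(z_0,z_1) ∈ ℂ² : z_1^{a_1a_2⋯a_n} = c·(z_0^{a_0}z_1 − 1)^{μ(a_2,…,a_n)}}. -/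

import Mathlib

open MvPolynomial

/-- The Milnor number of the chain type singularity associated to the tuple
`a = (a_1, …, a_n)`, with `μ(∅) = 1`. -/
def chainMu (a : List ℕ) : ℤ :=
  ∑ k ∈ Finset.range (a.length + 1), (-1 : ℤ) ^ k * ((a.drop k).prod : ℤ)

/-- The alternating-sign chain polynomial
`F̃(z_0,…,z_n) = z_0^{a_0} z_1 − z_1^{a_1} z_2 + ⋯ + (−1)^{n−1} z_{n−1}^{a_{n−1}} z_n
+ (−1)^n z_n^{a_n}` in variables indexed by `Fin (n+1)`. -/
noncomputable def chainAltMv (n : ℕ) (a : Fin (n + 1) → ℕ) :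
    MvPolynomial (Fin (n + 1)) ℂ :=
  ∑ k : Fin (n + 1),
    C ((-1 : ℂ) ^ (k : ℕ)) * X k ^ a k *
      (if h : (k : ℕ) + 1 < n + 1 then X (⟨(k : ℕ) + 1, h⟩ : Fin (n + 1)) else 1)

theorem chainMu_cons (a : ℕ) (l : List ℕ) :
    chainMu (a :: l) = ((a :: l).prod : ℤ) - chainMu l := by
  unfold chainMu
  rw [List.length_cons, Finset.sum_range_succ']
  simp only [List.drop_succ_cons, List.drop_zero, pow_succ, pow_zero]
  simp [Finset.sum_neg_distrib]
  ring

theorem chainMu_pos_and_le {l : List ℕ} (hl : ∀ x ∈ l, 2 ≤ x) :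
    0 < chainMu l ∧ chainMu l ≤ l.prod := by
  induction l with
  | nil => simp [chainMu]
  | cons a l ih =>
    obtain ⟨h1, h2⟩ := ih fun x hx => hl x (List.mem_cons_of_mem _ hx)
    have ha : (2 : ℤ) ≤ a := by exact_mod_cast hl a List.mem_cons_self
    rw [chainMu_cons, List.prod_cons]
    push_cast at *
    constructor <;> nlinarith

/-- For a nowhere vanishing sequence with `z_k ^ l_k * z_{k+1} = d_k w`, the normalisation
`z_N = 1` amounts to a single monomial equation between `z_0` and `w`. -/
theorem exists_pos_chain_eq_one_iff (a : ℕ) (l : List ℕ) (d : ℕ → ℝ) (hd : ∀ k, 0 < d k) :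
    ∃ c : ℝ, 0 < c ∧ ∀ (w : ℂ) (z : ℕ → ℂ), w ≠ 0 →
      (∀ k (hk : k < (a :: l).length), z k ≠ 0 ∧ z k ^ (a :: l)[k] * z (k + 1) = d k * w) →
      (z (a :: l).length = 1 ↔ z 0 ^ (a :: l).prod = c * w ^ chainMu l) := by
  induction l generalizing a d with
  | nil =>
    refine ⟨d 0, hd 0, fun w z hw hz => ?_⟩
    obtain ⟨h0, h1⟩ := hz 0 (by simp)
    simp only [List.getElem_cons_zero, zero_add] at h1
    simp only [List.length_cons, List.length_nil, zero_add, List.prod_cons, List.prod_nil, mul_one,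
      chainMu, List.drop_nil, Finset.range_one, Finset.sum_singleton, pow_zero, Nat.cast_one,
      zpow_one]
    rw [← h1]
    constructor
    · intro h; rw [h, mul_one]
    · intro h
      exact (mul_left_cancel₀ (pow_ne_zero a h0) (by rw [← h, mul_one])).symm
  | cons b l ih =>
    obtain ⟨c, hc, H⟩ := ih b (fun k => d (k + 1)) fun k => hd _
    refine ⟨d 0 ^ (b :: l).prod / c, div_pos (pow_pos (hd 0) _) hc, fun w z hw hz => ?_⟩
    have hrec := H w (fun k => z (k + 1)) hw fun k hk => by
      have := hz (k + 1) (by simpa using hk)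
      simpa using this
    obtain ⟨h0, h1⟩ := hz 0 (by simp)
    simp only [List.getElem_cons_zero, zero_add] at h1
    have hcc : (c : ℂ) ≠ 0 := by exact_mod_cast hc.ne'
    rw [List.length_cons, hrec, zero_add, chainMu_cons, List.prod_cons (a := a)]
    generalize (b :: l).prod = P
    have hpow : z 0 ^ (a * P) * z 1 ^ P = (d 0 : ℂ) ^ P * w ^ P := by
      rw [pow_mul, ← mul_pow, h1, mul_pow]
    rw [zpow_sub₀ hw, zpow_natCast]
    have hwz : w ^ chainMu l ≠ 0 := zpow_ne_zero _ hw
    have hz0 : z 0 ^ (a * P) ≠ 0 := pow_ne_zero _ h0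
    push_cast
    rw [div_mul_div_comm, eq_div_iff (mul_ne_zero hcc hwz), ← hpow]
    constructor
    · intro h; rw [h]
    · intro h; exact (mul_left_cancel₀ hz0 h).symm

/-- The critical point equations of an alternating chain sum, solved for its monomials. -/
theorem chain_critical_iff {n m : ℕ} (hn : 1 ≤ n) (hm0 : 0 < m) (b D : ℕ → ℕ)
    (hb : ∀ k, 1 ≤ k → k ≤ n → 2 ≤ b k) (hDn : D n = 1)
    (hD : ∀ k, k < n → D k = b (k + 1) * D (k + 1))
    (hm : (m : ℤ) = ∑ j ∈ Finset.range n, (-1 : ℤ) ^ j * (D (j + 1) : ℤ))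
    (y : ℕ → ℂ) :
    (∑ k ∈ Finset.range (n + 1), (-1 : ℂ) ^ k * (y k ^ b k * y (k + 1)) = 1 ∧
      ∀ k, 1 ≤ k → k < n → b (k + 1) * y (k + 1) ^ (b (k + 1) - 1) * y (k + 2) = y k ^ b k) ↔
    ∀ k, 1 ≤ k → k ≤ n → y k ≠ 0 ∧
      y k ^ b k * y (k + 1) = ((D k / m : ℝ) : ℂ) * (y 0 ^ b 0 * y 1 - 1) := by
  have hmC : (m : ℂ) = ∑ j ∈ Finset.range n, (-1 : ℂ) ^ j * (D (j + 1) : ℂ) := by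
    exact_mod_cast congrArg (Int.cast : ℤ → ℂ) hm
  have hmne : (m : ℂ) ≠ 0 := by exact_mod_cast hm0.ne'
  have hsum : ∀ t : ℂ, (∀ k, 1 ≤ k → k ≤ n → y k ^ b k * y (k + 1) = D k * t) →
      ∑ k ∈ Finset.range (n + 1), (-1 : ℂ) ^ k * (y k ^ b k * y (k + 1)) =
        y 0 ^ b 0 * y 1 - m * t := by
    intro t ht
    rw [Finset.sum_range_succ', hmC, Finset.sum_mul, sub_eq_add_neg, ← Finset.sum_neg_distrib,
      add_comm]
    congr 1
    · simp
    · refine Finset.sum_congr rfl fun k hk => ?_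
      rw [ht (k + 1) (by omega) (by simpa using hk)]
      ring
  have hpow : ∀ k, 1 ≤ k → k < n → y (k + 1) * (b (k + 1) * y (k + 1) ^ (b (k + 1) - 1) * y (k + 2))
      = b (k + 1) * (y (k + 1) ^ b (k + 1) * y (k + 2)) := by
    intro k hk hkn
    have := hb (k + 1) (by omega) (by omega)
    rw [← pow_sub_one_mul (show b (k + 1) ≠ 0 by omega) (y (k + 1))]
    ring
  constructor
  · rintro ⟨hF, hder⟩
    have hT : ∀ k, k ≤ n → 1 ≤ k →
        y k ^ b k * y (k + 1) = D k * (y n ^ b n * y (n + 1)) := by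
      intro k hk
      induction hk using Nat.decreasingInduction with
      | self => simp [hDn]
      | of_succ k hk ih =>
        intro h1
        rw [← hder k h1 hk, mul_comm, hpow k h1 hk, ih (by omega), hD k hk]
        push_cast; ring
    rw [hsum _ fun k h1 h2 => hT k h2 h1] at hF
    have hw : y 0 ^ b 0 * y 1 - 1 = m * (y n ^ b n * y (n + 1)) := by linear_combination hF
    have hD1 : (D 1 : ℂ) ≠ 0 := by
      have : ∀ k, k ≤ n → 1 ≤ k → D k ≠ 0 := by
        intro k hk
        induction hk using Nat.decreasingInduction with
        | self => simp [hDn]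
        | of_succ k hk ih =>
          intro h1
          rw [hD k hk]
          have := hb (k + 1) (by omega) (by omega)
          exact mul_ne_zero (by omega) (ih (by omega))
      exact_mod_cast this 1 hn le_rfl
    have hne : ∀ k, 1 ≤ k → k ≤ n → y k ≠ 0 := by
      intro k hk
      induction k, hk using Nat.le_induction with
      | base =>
        intro _ h
        have h1 := hT 1 hn le_rfl
        have hb1 := hb 1 le_rfl hn
        rw [h, zero_pow (by omega), zero_mul] at h1
        have h2 := (mul_eq_zero.mp h1.symm).resolve_left hD1
        rw [h2, h] at hw
        simp at hw
      | succ k hk ih =>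
        intro hkn h
        have h1 := hder k hk (by omega)
        have hb1 := hb (k + 1) (by omega) hkn
        rw [h, zero_pow (by omega)] at h1
        exact pow_ne_zero _ (ih (by omega)) (by rw [← h1]; ring)
    intro k h1 h2
    refine ⟨hne k h1 h2, ?_⟩
    rw [hT k h2 h1, hw]
    push_cast
    field_simp
  · intro H
    have hT : ∀ k, 1 ≤ k → k ≤ n →
        y k ^ b k * y (k + 1) = D k * ((y 0 ^ b 0 * y 1 - 1) / m) := by
      intro k h1 h2
      rw [(H k h1 h2).2]
      push_cast
      ring
    refine ⟨?_, fun k h1 h2 => ?_⟩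
    · rw [hsum _ hT]
      field_simp
      ring
    · apply mul_left_cancel₀ (H (k + 1) (by omega) (by omega)).1
      rw [hpow k h1 h2, hT (k + 1) (by omega) (by omega), mul_comm (y (k + 1)),
        hT k h1 h2.le, hD k h2]
      push_cast; ring

theorem eval_chainAltMv (n : ℕ) (a : Fin (n + 1) → ℕ) (b : ℕ → ℕ) (y : ℕ → ℂ)
    (hb : ∀ k : Fin (n + 1), b k = a k) (hy : y (n + 1) = 1) :
    eval (fun k : Fin (n + 1) => y k) (chainAltMv n a) =
      ∑ k ∈ Finset.range (n + 1), (-1 : ℂ) ^ k * (y k ^ b k * y (k + 1)) := by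
  rw [Finset.sum_range, chainAltMv, map_sum]
  refine Finset.sum_congr rfl fun k _ => ?_
  rw [hb]
  split_ifs with h
  · simp [mul_assoc]
  · have : (k : ℕ) = n := by omega
    simp [this, hy]

theorem eval_pderiv_chainAltMv (n : ℕ) (a : Fin (n + 1) → ℕ) (b : ℕ → ℕ) (y : ℕ → ℂ)
    (hb : ∀ k : Fin (n + 1), b k = a k) (hy : y (n + 1) = 1) (k : ℕ) (hk : k + 1 < n + 1) :
    eval (fun k : Fin (n + 1) => y k) (pderiv ⟨k + 1, hk⟩ (chainAltMv n a)) =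
      (-1 : ℂ) ^ (k + 1) *
        (b (k + 1) * y (k + 1) ^ (b (k + 1) - 1) * y (k + 2) - y k ^ b k) := by
  have key : ∀ j : Fin (n + 1),
      eval (fun k : Fin (n + 1) => y k) (pderiv ⟨k + 1, hk⟩
        (C ((-1 : ℂ) ^ (j : ℕ)) * X j ^ a j *
          (if h : (j : ℕ) + 1 < n + 1 then X (⟨(j : ℕ) + 1, h⟩ : Fin (n + 1)) else 1))) =
      (if (j : ℕ) = k + 1 then (-1 : ℂ) ^ (j : ℕ) * (b j * y j ^ (b j - 1) * y (j + 1)) else 0) +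
      (if (j : ℕ) = k then (-1 : ℂ) ^ (j : ℕ) * y j ^ b j else 0) := by
    intro j
    rw [hb]
    have hnext : eval (fun k : Fin (n + 1) => y k)
        (if h : (j : ℕ) + 1 < n + 1 then X (⟨(j : ℕ) + 1, h⟩ : Fin (n + 1)) else 1) =
        y (j + 1) := by
      split_ifs with h
      · simp
      · have : (j : ℕ) = n := by omega
        simp [this, hy]
    have hdnext : pderiv ⟨k + 1, hk⟩
        (if h : (j : ℕ) + 1 < n + 1 then X (⟨(j : ℕ) + 1, h⟩ : Fin (n + 1)) else 1) =
        if (j : ℕ) = k then (1 : MvPolynomial (Fin (n + 1)) ℂ) else 0 := by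
      split_ifs with h h1 h1
      · subst h1; exact pderiv_X_self _
      · exact pderiv_X_of_ne (by simpa [Fin.ext_iff] using h1)
      · omega
      · exact pderiv_one
    have hdX : pderiv ⟨k + 1, hk⟩ (X j) =
        if (j : ℕ) = k + 1 then (1 : MvPolynomial (Fin (n + 1)) ℂ) else 0 := by
      split_ifs with h
      · rw [show (⟨k + 1, hk⟩ : Fin (n + 1)) = j from Fin.ext h.symm, pderiv_X_self]
      · exact pderiv_X_of_ne (by simpa [Fin.ext_iff] using h)
    rw [pderiv_mul, pderiv_mul, pderiv_pow, pderiv_C, hdnext, hdX, map_add, map_mul, hnext]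
    split_ifs <;> simp <;> ring
  rw [chainAltMv, map_sum, map_sum, Finset.sum_congr rfl fun j _ => key j,
    ← Finset.sum_range (fun j : ℕ =>
      (if j = k + 1 then (-1 : ℂ) ^ j * (b j * y j ^ (b j - 1) * y (j + 1)) else 0) +
      (if j = k then (-1 : ℂ) ^ j * y j ^ b j else 0)), Finset.sum_add_distrib,
    Finset.sum_ite_eq', Finset.sum_ite_eq', if_pos (by simpa using hk),
    if_pos (by simp; omega)]
  ring

/-- Let `n ≥ 2`, `a_0 ≥ 1`, `a_1,…,a_n ≥ 2`, and let
`V = {z : F̃(z) = 1, ∂F̃/∂z_k(z) = 0 for k = 2,…,n}`.  Then there is a real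
`c > 0` such that `(z_0,…,z_n) ↦ (z_0, z_1)` is a bijection from `V` onto the
plane curve `{(z_0,z_1) : z_1^{a_1⋯a_n} = c (z_0^{a_0} z_1 − 1)^{μ(a_2,…,a_n)}}`. -/
theorem stmt17 (n : ℕ) (hn : 2 ≤ n) (a : Fin (n + 1) → ℕ)
    (h0 : 1 ≤ a 0) (h2 : ∀ k : Fin (n + 1), 1 ≤ (k : ℕ) → 2 ≤ a k)
    (m : ℕ) (hm : (m : ℤ) = chainMu ((List.ofFn a).drop 2)) :
    ∃ c : ℝ, 0 < c ∧
      Set.BijOn (fun z : Fin (n + 1) → ℂ => (z 0, z 1))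
        {z : Fin (n + 1) → ℂ | eval z (chainAltMv n a) = 1 ∧
          ∀ k : Fin (n + 1), 2 ≤ (k : ℕ) →
            eval z (pderiv k (chainAltMv n a)) = 0}
        {p : ℂ × ℂ | p.2 ^ ((List.ofFn a).drop 1).prod =
          (c : ℂ) * (p.1 ^ a 0 * p.2 - 1) ^ m} := by
  set L := List.ofFn a
  have hlen : L.length = n + 1 := by simp [L]
  let b : ℕ → ℕ := fun k => if h : k < n + 1 then a ⟨k, h⟩ else 1
  have hba : ∀ k : Fin (n + 1), b k = a k := fun k => dif_pos k.isLt
  have hLb : ∀ k (hk : k < L.length), L[k] = b k := fun k hk => by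
    have hk' : k < n + 1 := by omega
    rw [hba ⟨k, hk'⟩, List.getElem_ofFn]
  have hb2 : ∀ k, 1 ≤ k → k ≤ n → 2 ≤ b k := fun k h1 hk => by
    have := h2 ⟨k, by omega⟩ h1
    rwa [← hba] at this
  let D : ℕ → ℕ := fun k => (L.drop (k + 1)).prod
  have hDn : D n = 1 := by simp [D, List.drop_of_length_le, hlen]
  have hD : ∀ k, k < n → D k = b (k + 1) * D (k + 1) := fun k hk => by
    simp only [D]
    rw [List.drop_eq_getElem_cons (by omega : k + 1 < L.length), List.prod_cons, hLb]
  have hL2 : ∀ j, 1 ≤ j → ∀ x ∈ L.drop j, 2 ≤ x := fun j hj x hx => by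
    obtain ⟨i, hi, rfl⟩ := List.mem_iff_getElem.mp hx
    rw [List.length_drop] at hi
    rw [List.getElem_drop, hLb]
    exact hb2 _ (by omega) (by omega)
  have hm0 : 0 < m := by
    have := (chainMu_pos_and_le (hL2 2 (by omega))).1
    omega
  have hD0 : ∀ k, 0 < D k := fun k =>
    List.prod_pos fun x hx => by have := hL2 (k + 1) (by omega) x hx; omega
  have hmD : (m : ℤ) = ∑ j ∈ Finset.range n, (-1 : ℤ) ^ j * (D (j + 1) : ℤ) := by
    rw [hm, chainMu, List.length_drop, hlen, show n + 1 - 2 + 1 = n by omega]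
    refine Finset.sum_congr rfl fun j _ => ?_
    rw [List.drop_drop, add_comm 2 j]
  have hV : ∀ y : ℕ → ℂ, y (n + 1) = 1 →
      ((fun k : Fin (n + 1) => y k) ∈ {z : Fin (n + 1) → ℂ | eval z (chainAltMv n a) = 1 ∧
          ∀ k : Fin (n + 1), 2 ≤ (k : ℕ) → eval z (pderiv k (chainAltMv n a)) = 0} ↔
        ∀ k, 1 ≤ k → k ≤ n → y k ≠ 0 ∧
          y k ^ b k * y (k + 1) = ((D k / m : ℝ) : ℂ) * (y 0 ^ b 0 * y 1 - 1)) := by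
    intro y hy
    rw [← chain_critical_iff (by omega) hm0 b D hb2 hDn hD hmD y, Set.mem_ofPred_eq,
      eval_chainAltMv n a b y hba hy]
    refine and_congr_right fun _ => ⟨fun H k h1 hk => ?_, fun H k hk => ?_⟩
    · have := H ⟨k + 1, by omega⟩ (by simpa using h1)
      rw [eval_pderiv_chainAltMv n a b y hba hy] at this
      exact sub_eq_zero.mp ((mul_eq_zero.mp this).resolve_left (by simp))
    · obtain ⟨k, hk'⟩ := k
      obtain ⟨k, rfl⟩ : ∃ j, k = j + 1 := ⟨k - 1, by simp at hk; omega⟩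
      rw [eval_pderiv_chainAltMv n a b y hba hy, H k (by simpa using hk) (by omega), sub_self,
        mul_zero]
  have hd : ∀ k, (0 : ℝ) < D k / m := fun k =>
    div_pos (by exact_mod_cast hD0 k) (by exact_mod_cast hm0)
  have hdC : ∀ k, ((D k / m : ℝ) : ℂ) ≠ 0 := fun k => by exact_mod_cast (hd k).ne'
  obtain ⟨c, hc, hcurve⟩ := exists_pos_chain_eq_one_iff L[1] (L.drop 2)
    (fun k => D (k + 1) / m) fun k => hd _
  rw [← List.drop_eq_getElem_cons (by omega : 1 < L.length), ← hm] at hcurve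
  simp only [zpow_natCast, List.length_drop, hlen, Nat.add_sub_cancel, List.getElem_drop,
    hLb] at hcurve
  have hcurve' : ∀ y : ℕ → ℂ, y 0 ^ b 0 * y 1 - 1 ≠ 0 →
      (∀ k, 1 ≤ k → k ≤ n → y k ≠ 0 ∧
        y k ^ b k * y (k + 1) = ((D k / m : ℝ) : ℂ) * (y 0 ^ b 0 * y 1 - 1)) →
      (y (n + 1) = 1 ↔ y 1 ^ (L.drop 1).prod = c * (y 0 ^ b 0 * y 1 - 1) ^ m) := by
    intro y hw hy
    refine hcurve _ (fun k => y (k + 1)) hw fun k hk => ?_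
    rw [add_comm 1 k]
    exact hy (k + 1) (by omega) (by omega)
  have hw0 : ∀ y : ℕ → ℂ, (∀ k, 1 ≤ k → k ≤ n → y k ≠ 0 ∧
        y k ^ b k * y (k + 1) = ((D k / m : ℝ) : ℂ) * (y 0 ^ b 0 * y 1 - 1)) →
      y 0 ^ b 0 * y 1 - 1 ≠ 0 := by
    intro y hy hw
    obtain ⟨h1, h3⟩ := hy 1 le_rfl (by omega)
    rw [hw, mul_zero] at h3
    exact mul_ne_zero (pow_ne_zero _ h1) (hy 2 (by omega) hn).1 h3
  have hext : ∀ z : Fin (n + 1) → ℂ, ∃ y : ℕ → ℂ, y (n + 1) = 1 ∧ z = fun k : Fin (n + 1) => y k := fun z =>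
    ⟨fun k => if h : k < n + 1 then z ⟨k, h⟩ else 1, dif_neg (lt_irrefl _),
      funext fun k => by dsimp only; rw [dif_pos k.isLt]⟩
  have hval1 : ((1 : Fin (n + 1)) : ℕ) = 1 := by
    rw [Fin.val_one', Nat.mod_eq_of_lt (by omega)]
  have hb0 : b 0 = a 0 := hba 0
  refine ⟨c, hc, ?_, ?_, ?_⟩
  · intro z hz
    obtain ⟨y, hy, rfl⟩ := hext z
    rw [hV y hy] at hz
    have h := (hcurve' y (hw0 y hz) hz).mp hy
    rw [hb0] at h
    simpa only [Set.mem_ofPred_eq, hval1, Fin.val_zero] using h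
  · intro z hz z' hz' hzz
    obtain ⟨y, hy, rfl⟩ := hext z
    obtain ⟨y', hy', rfl⟩ := hext z'
    rw [hV _ ‹_›] at hz hz'
    simp only [hval1, Fin.val_zero, Prod.mk.injEq] at hzz
    have key : ∀ k, 1 ≤ k → k ≤ n → y k = y' k := by
      intro k hk
      induction k, hk using Nat.le_induction with
      | base => exact fun _ => hzz.2
      | succ k hk ih =>
        intro hkn
        obtain ⟨h1, h3⟩ := hz k hk (by omega)
        have h4 := (hz' k hk (by omega)).2
        rw [← hzz.1, ← hzz.2, ← h3, ← ih (by omega)] at h4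
        exact (mul_left_cancel₀ (pow_ne_zero _ h1) h4).symm
    funext k
    rcases Nat.eq_zero_or_pos (k : ℕ) with h | h
    · simpa [h] using hzz.1
    · exact key k h (by omega)
  · rintro ⟨p, q⟩ hpq
    simp only [Set.mem_ofPred_eq] at hpq
    have hcC : (c : ℂ) ≠ 0 := by exact_mod_cast hc.ne'
    have hq : q ≠ 0 := by
      rintro rfl
      have hprod : (L.drop 1).prod ≠ 0 := (hD0 0).ne'
      rw [zero_pow hprod, mul_zero, zero_sub] at hpq
      exact mul_ne_zero hcC (pow_ne_zero m (by simp)) hpq.symm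
    have hw : p ^ a 0 * q - 1 ≠ 0 := by
      intro h
      rw [h, zero_pow hm0.ne', mul_zero] at hpq
      exact pow_ne_zero _ hq hpq
    let x : ℕ → ℂ := fun k => Nat.rec q
      (fun j t => ((D (j + 1) / m : ℝ) : ℂ) * (p ^ a 0 * q - 1) / t ^ b (j + 1)) k
    have hx : ∀ k, x k ≠ 0 := by
      intro k
      induction k with
      | zero => exact hq
      | succ k ih => exact div_ne_zero (mul_ne_zero (hdC _) hw) (pow_ne_zero _ ih)
    let y : ℕ → ℂ := fun k => Nat.casesOn k p x
    have hsol : ∀ k, 1 ≤ k → k ≤ n → y k ≠ 0 ∧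
        y k ^ b k * y (k + 1) = ((D k / m : ℝ) : ℂ) * (y 0 ^ b 0 * y 1 - 1) := by
      intro k hk _
      obtain ⟨k, rfl⟩ : ∃ j, k = j + 1 := ⟨k - 1, by omega⟩
      refine ⟨hx k, ?_⟩
      rw [hb0]
      exact mul_div_cancel₀ _ (pow_ne_zero _ (hx k))
    have hy : y (n + 1) = 1 := (hcurve' y (hw0 y hsol) hsol).mpr (by rw [hb0]; exact hpq)
    refine ⟨fun k : Fin (n + 1) => y k, (hV y hy).mpr hsol, ?_⟩
    simp only [hval1, Fin.val_zero]
    rfl
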